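/- For every ξ = (ξ₀,ξ₁,ξ₂,ξ₃) ∈ ℝ⁴ with (ξ₁,ξ₂,ξ₃) ≠ (0,0,0) and every f = (f₁,f₂,f₃) ∈ ℂ³, a vector Y ∈ ℂ^55 satisfies B(ξ)·Y = G(ξ,f) if and only if there exist c₁, …, c₉ ∈ ℂ with Y = Y₁(ξ,f) + Σ_{j=1}^9 c_j·η_j(ξ); moreover the coefficients c₁, …, c₉ are uniquely determined by Y. -/

import Mathlib

open Matrix Complex

/-- `e i` is the `i`-th standard basis vector of `ℂ^55` (`1 ≤ i ≤ 55`, one-based). -/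
def e (i : ℕ) : Fin 55 → ℂ := fun j => if (j : ℕ) + 1 = i then 1 else 0

def α₁ : Fin 55 → ℂ := e 5 + e 10
def α₂ (μ τ : ℝ) : Fin 55 → ℂ :=
  (τ : ℂ) • e 13 - (μ : ℂ) • (e 18 + e 19 + e 20) + e 47 + e 48 + e 49
def α₃ (μ τ : ℝ) : Fin 55 → ℂ :=
  (τ : ℂ) • e 14 - (μ : ℂ) • (e 28 + e 29 + e 30) + e 50 + e 51 + e 52
def α₄ (μ τ : ℝ) : Fin 55 → ℂ :=
  (τ : ℂ) • e 15 - (μ : ℂ) • (e 38 + e 39 + e 40) + e 53 + e 54 + e 55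

/-- The `16 × 55` matrix `H`. -/
def Hm (μ τ : ℝ) : Matrix (Fin 16) (Fin 55) ℂ :=
  Matrix.of ![-α₁, -α₂ μ τ, -α₃ μ τ, -α₄ μ τ, e 1, e 2, e 3, e 4, e 5, e 6, e 7, e 8,
    e 9, e 10, e 11, e 16]

/-- The `16 × 55` matrix `H₀`. -/
def Hm0 (μ τ : ℝ) : Matrix (Fin 16) (Fin 55) ℂ :=
  Matrix.of ![e 21, e 17, e 27, e 37, e 22, e 23, -α₂ μ τ, e 31, e 32, e 33, -α₃ μ τ,
    e 41, e 42, e 43, -α₄ μ τ, e 12]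

/-- The `16 × 55` matrix `H₁`. -/
def Hm1 : Matrix (Fin 16) (Fin 55) ℂ :=
  Matrix.of ![e 18, e 21, e 31, e 41, e 24, e 25, -α₁, e 28, e 34, e 35, e 4, e 38,
    e 44, e 45, e 8, e 13]

/-- The `16 × 55` matrix `H₂`. -/
def Hm2 : Matrix (Fin 16) (Fin 55) ℂ :=
  Matrix.of ![e 24, e 22, e 32, e 42, e 19, e 26, e 1, e 34, e 29, e 36, e 5, e 44,
    e 39, e 46, e 9, e 14]

/-- The `16 × 55` matrix `H₃`. -/
def Hm3 : Matrix (Fin 16) (Fin 55) ℂ :=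
  Matrix.of ![e 25, e 23, e 33, e 43, e 26, e 20, e 2, e 35, e 36, e 30, e 6, e 45,
    e 46, e 40, e 10, e 15]

/-- The four matrices `H₀, H₁, H₂, H₃`. -/
def HmB (μ τ : ℝ) : Fin 4 → Matrix (Fin 16) (Fin 55) ℂ := ![Hm0 μ τ, Hm1, Hm2, Hm3]

/-- The `64 × 55` complex matrix `B(ξ)`, obtained by stacking the four `16 × 55` blocks
`iξ₀H − H₀`, `iξ₁H − H₁`, `iξ₂H − H₂`, `iξ₃H − H₃`. -/
noncomputable def B (μ τ : ℝ) (ξ : Fin 4 → ℝ) : Matrix (Fin 64) (Fin 55) ℂ :=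
  Matrix.of fun i j =>
    Complex.I * (ξ ⟨(i : ℕ) / 16, by have := i.isLt; omega⟩ : ℂ) *
        Hm μ τ ⟨(i : ℕ) % 16, by have := i.isLt; omega⟩ j
      - HmB μ τ ⟨(i : ℕ) / 16, by have := i.isLt; omega⟩
          ⟨(i : ℕ) % 16, by have := i.isLt; omega⟩ j

/-- `a(ξ) = (μ((iξ₁)² + (iξ₂)² + (iξ₃)²) − iξ₀)/τ`. -/
noncomputable def aC (μ τ : ℝ) (ξ : Fin 4 → ℝ) : ℂ :=
  ((μ : ℂ) * ((Complex.I * ξ 1) ^ 2 + (Complex.I * ξ 2) ^ 2 + (Complex.I * ξ 3) ^ 2)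
    - Complex.I * ξ 0) / (τ : ℂ)

/-- `b(ξ) = ((iξ₁)² + (iξ₂)² + (iξ₃)²)/a(ξ)`. -/
noncomputable def bC (μ τ : ℝ) (ξ : Fin 4 → ℝ) : ℂ :=
  ((Complex.I * ξ 1) ^ 2 + (Complex.I * ξ 2) ^ 2 + (Complex.I * ξ 3) ^ 2) / aC μ τ ξ

/-- The vector `Y(y₃, y₇, y₁₁, y₁₆, w) ∈ ℂ^55`. -/
noncomputable def Yv (ξ : Fin 4 → ℝ) (y3 y7 y11 y16 : ℂ) (w : Fin 9 → ℂ) : Fin 55 → ℂ :=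
  let z : Fin 4 → ℂ := fun k => Complex.I * ξ k
  ![z 2 * y3, z 3 * y3, y3,
    z 1 * y7, z 2 * y7, z 3 * y7, y7,
    z 1 * y11, z 2 * y11, z 3 * y11, y11,
    z 0 * y16, z 1 * y16, z 2 * y16, z 3 * y16, y16,
    (z 0) ^ 2 * y3, (z 1) ^ 2 * y3, (z 2) ^ 2 * y3, (z 3) ^ 2 * y3,
    z 0 * z 1 * y3, z 0 * z 2 * y3, z 0 * z 3 * y3,
    z 1 * z 2 * y3, z 1 * z 3 * y3, z 2 * z 3 * y3,
    (z 0) ^ 2 * y7, (z 1) ^ 2 * y7, (z 2) ^ 2 * y7, (z 3) ^ 2 * y7,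
    z 0 * z 1 * y7, z 0 * z 2 * y7, z 0 * z 3 * y7,
    z 1 * z 2 * y7, z 1 * z 3 * y7, z 2 * z 3 * y7,
    (z 0) ^ 2 * y11, (z 1) ^ 2 * y11, (z 2) ^ 2 * y11, (z 3) ^ 2 * y11,
    z 0 * z 1 * y11, z 0 * z 2 * y11, z 0 * z 3 * y11,
    z 1 * z 2 * y11, z 1 * z 3 * y11, z 2 * z 3 * y11,
    w 0, w 1, w 2, w 3, w 4, w 5, w 6, w 7, w 8]

/-- `ê j` is the `j`-th standard basis vector of `ℂ⁹`. -/
def eh (j : Fin 9) : Fin 9 → ℂ := fun k => if k = j then 1 else 0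

/-- The nine null-space vectors `η₁(ξ), …, η₉(ξ)` (indexed by `Fin 9`, zero-based). -/
noncomputable def ηv (μ τ : ℝ) (ξ : Fin 4 → ℝ) (j : Fin 9) : Fin 55 → ℂ :=
  let a := aC μ τ ξ
  let b := bC μ τ ξ
  let D := a ^ 2 * b * (τ : ℂ)
  if (j : ℕ) < 3 then
    Yv ξ ((ξ 1 : ℂ) ^ 2 / D + 1 / (a * τ)) ((ξ 1 : ℂ) * (ξ 2 : ℂ) / D)
      ((ξ 1 : ℂ) * (ξ 3 : ℂ) / D) (-(Complex.I * ξ 1) / (a * b * τ)) (eh j)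
  else if (j : ℕ) < 6 then
    Yv ξ ((ξ 1 : ℂ) * (ξ 2 : ℂ) / D) ((ξ 2 : ℂ) ^ 2 / D + 1 / (a * τ))
      ((ξ 2 : ℂ) * (ξ 3 : ℂ) / D) (-(Complex.I * ξ 2) / (a * b * τ)) (eh j)
  else
    Yv ξ ((ξ 1 : ℂ) * (ξ 3 : ℂ) / D) ((ξ 2 : ℂ) * (ξ 3 : ℂ) / D)
      ((ξ 3 : ℂ) ^ 2 / D + 1 / (a * τ)) (-(Complex.I * ξ 3) / (a * b * τ)) (eh j)

/-- The particular solution `Y₁(ξ, f)`. -/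
noncomputable def Y1 (μ τ : ℝ) (ξ : Fin 4 → ℝ) (f : Fin 3 → ℂ) : Fin 55 → ℂ :=
  let a := aC μ τ ξ
  let b := bC μ τ ξ
  let D := a ^ 2 * b * (τ : ℂ)
  let S := Complex.I * ξ 1 * f 0 + Complex.I * ξ 2 * f 1 + Complex.I * ξ 3 * f 2
  Yv ξ (Complex.I * ξ 1 * S / D - f 0 / (a * τ)) (Complex.I * ξ 2 * S / D - f 1 / (a * τ))
    (Complex.I * ξ 3 * S / D - f 2 / (a * τ)) (S / (a * b * τ)) 0

/-- The right-hand side `G(ξ, f) ∈ ℂ⁶⁴`: the stack of the four `16`-blocks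
`g⁰(f) − iξ₀ g¹(f)`, `−iξ₁ g¹(f)`, `−iξ₂ g¹(f)`, `−iξ₃ g¹(f)`. -/
noncomputable def Gv (ξ : Fin 4 → ℝ) (f : Fin 3 → ℂ) : Fin 64 → ℂ := fun i =>
  let g1 : Fin 16 → ℂ := ![0, f 0, f 1, f 2, 0, 0, 0, 0, 0, 0, 0, 0, 0, 0, 0, 0]
  let g0 : Fin 16 → ℂ := ![0, 0, 0, 0, 0, 0, f 0, 0, 0, 0, f 1, 0, 0, 0, f 2, 0]
  if h : (i : ℕ) < 16 then
    g0 ⟨(i : ℕ), h⟩ - Complex.I * ξ 0 * g1 ⟨(i : ℕ), h⟩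
  else
    -(Complex.I * (ξ ⟨(i : ℕ) / 16, by have := i.isLt; omega⟩ : ℂ)) *
      g1 ⟨(i : ℕ) % 16, by have := i.isLt; omega⟩

lemma e_dot (i : ℕ) (h : i < 55) (Y : Fin 55 → ℂ) : e (i + 1) ⬝ᵥ Y = Y ⟨i, h⟩ := by
  unfold dotProduct e
  rw [Finset.sum_eq_single ⟨i, h⟩]
  · simp
  · intro b _ hb
    have : (b : ℕ) ≠ i := fun hh => hb (Fin.ext hh)
    simp [this]
  · simp

lemma B_iff (μ τ : ℝ) (ξ : Fin 4 → ℝ) (f : Fin 3 → ℂ) (Y : Fin 55 → ℂ) :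
    (B μ τ ξ).mulVec Y = Gv ξ f ↔ ∀ (k : Fin 4) (r : Fin 16),
      Complex.I * ξ k * (Hm μ τ r ⬝ᵥ Y) - HmB μ τ k r ⬝ᵥ Y =
        (if k = 0 then
          (![0, 0, 0, 0, 0, 0, f 0, 0, 0, 0, f 1, 0, 0, 0, f 2, 0] : Fin 16 → ℂ) r else 0)
        - Complex.I * ξ k *
          (![0, f 0, f 1, f 2, 0, 0, 0, 0, 0, 0, 0, 0, 0, 0, 0, 0] : Fin 16 → ℂ) r := by
  have hrow : ∀ i : Fin 64, (B μ τ ξ).mulVec Y i =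
      Complex.I * ξ ⟨(i : ℕ) / 16, by have := i.isLt; omega⟩ *
        (Hm μ τ ⟨(i : ℕ) % 16, by have := i.isLt; omega⟩ ⬝ᵥ Y) -
      HmB μ τ ⟨(i : ℕ) / 16, by have := i.isLt; omega⟩
        ⟨(i : ℕ) % 16, by have := i.isLt; omega⟩ ⬝ᵥ Y := by
    intro i
    simp only [Matrix.mulVec, dotProduct, B, Matrix.of_apply, Finset.mul_sum,
      ← Finset.sum_sub_distrib]
    refine Finset.sum_congr rfl fun j _ => ?_
    ring
  have hG : ∀ i : Fin 64, Gv ξ f i =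
      (if (⟨(i : ℕ) / 16, by have := i.isLt; omega⟩ : Fin 4) = 0 then
          (![0, 0, 0, 0, 0, 0, f 0, 0, 0, 0, f 1, 0, 0, 0, f 2, 0] : Fin 16 → ℂ)
            ⟨(i : ℕ) % 16, by have := i.isLt; omega⟩ else 0)
        - Complex.I * ξ ⟨(i : ℕ) / 16, by have := i.isLt; omega⟩ *
          (![0, f 0, f 1, f 2, 0, 0, 0, 0, 0, 0, 0, 0, 0, 0, 0, 0] : Fin 16 → ℂ)
            ⟨(i : ℕ) % 16, by have := i.isLt; omega⟩ := by
    intro i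
    unfold Gv
    by_cases h : (i : ℕ) < 16
    · have h1 : (i : ℕ) / 16 = 0 := by omega
      have h2 : (i : ℕ) % 16 = i := by omega
      simp only [h, h1, h2, dite_true]
      rfl
    · have h1 : (⟨(i : ℕ) / 16, by have := i.isLt; omega⟩ : Fin 4) ≠ 0 := by
        intro hh
        have := congrArg Fin.val hh
        simp at this
        omega
      simp only [h, h1, dite_false, if_false]
      ring
  constructor
  · intro h k r
    have h1 := congrFun h ⟨16 * k + r, by omega⟩
    rw [hrow, hG] at h1
    have e1 : (16 * (k : ℕ) + r) / 16 = k := by omega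
    have e2 : (16 * (k : ℕ) + r) % 16 = r := by omega
    simp only [e1, e2, Fin.eta] at h1
    exact h1
  · intro h
    funext i
    rw [hrow, hG]
    exact h _ _

lemma α₁_dot (Y : Fin 55 → ℂ) : α₁ ⬝ᵥ Y = Y 4 + Y 9 := by
  rw [α₁, add_dotProduct, e_dot 4 (by norm_num), e_dot 9 (by norm_num)]
  rfl

lemma α₂_dot (μ τ : ℝ) (Y : Fin 55 → ℂ) : α₂ μ τ ⬝ᵥ Y =
    τ * Y 12 - μ * (Y 17 + Y 18 + Y 19) + Y 46 + Y 47 + Y 48 := by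
  simp only [α₂, add_dotProduct, sub_dotProduct, smul_dotProduct, smul_eq_mul]
  rw [e_dot 12 (by norm_num), e_dot 17 (by norm_num), e_dot 18 (by norm_num),
    e_dot 19 (by norm_num), e_dot 46 (by norm_num), e_dot 47 (by norm_num),
    e_dot 48 (by norm_num)]
  rfl

lemma α₃_dot (μ τ : ℝ) (Y : Fin 55 → ℂ) : α₃ μ τ ⬝ᵥ Y =
    τ * Y 13 - μ * (Y 27 + Y 28 + Y 29) + Y 49 + Y 50 + Y 51 := by
  simp only [α₃, add_dotProduct, sub_dotProduct, smul_dotProduct, smul_eq_mul]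
  rw [e_dot 13 (by norm_num), e_dot 27 (by norm_num), e_dot 28 (by norm_num),
    e_dot 29 (by norm_num), e_dot 49 (by norm_num), e_dot 50 (by norm_num),
    e_dot 51 (by norm_num)]
  rfl

lemma α₄_dot (μ τ : ℝ) (Y : Fin 55 → ℂ) : α₄ μ τ ⬝ᵥ Y =
    τ * Y 14 - μ * (Y 37 + Y 38 + Y 39) + Y 52 + Y 53 + Y 54 := by
  simp only [α₄, add_dotProduct, sub_dotProduct, smul_dotProduct, smul_eq_mul]
  rw [e_dot 14 (by norm_num), e_dot 37 (by norm_num), e_dot 38 (by norm_num),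
    e_dot 39 (by norm_num), e_dot 52 (by norm_num), e_dot 53 (by norm_num),
    e_dot 54 (by norm_num)]
  rfl

lemma Hm_dot (μ τ : ℝ) (Y : Fin 55 → ℂ) (r : Fin 16) : Hm μ τ r ⬝ᵥ Y =
    ![-(Y 4 + Y 9), -(α₂ μ τ ⬝ᵥ Y), -(α₃ μ τ ⬝ᵥ Y), -(α₄ μ τ ⬝ᵥ Y), Y 0, Y 1, Y 2, Y 3, Y 4,
      Y 5, Y 6, Y 7, Y 8, Y 9, Y 10, Y 15] r := by
  rw [← α₁_dot, ← neg_dotProduct, ← neg_dotProduct, ← neg_dotProduct, ← neg_dotProduct]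
  fin_cases r <;> first | rfl | exact e_dot _ (by norm_num) Y

lemma Hm0_dot (μ τ : ℝ) (Y : Fin 55 → ℂ) (r : Fin 16) : HmB μ τ 0 r ⬝ᵥ Y =
    ![Y 20, Y 16, Y 26, Y 36, Y 21, Y 22, -(α₂ μ τ ⬝ᵥ Y), Y 30, Y 31, Y 32, -(α₃ μ τ ⬝ᵥ Y),
    Y 40, Y 41, Y 42, -(α₄ μ τ ⬝ᵥ Y), Y 11] r := by
  rw [← neg_dotProduct, ← neg_dotProduct, ← neg_dotProduct]
  fin_cases r <;> first | rfl | exact e_dot _ (by norm_num) Y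

lemma Hm1_dot (μ τ : ℝ) (Y : Fin 55 → ℂ) (r : Fin 16) : HmB μ τ 1 r ⬝ᵥ Y =
    ![Y 17, Y 20, Y 30, Y 40, Y 23, Y 24, -(Y 4 + Y 9), Y 27, Y 33, Y 34, Y 3, Y 37,
    Y 43, Y 44, Y 7, Y 12] r := by
  rw [← α₁_dot, ← neg_dotProduct]
  fin_cases r <;> first | rfl | exact e_dot _ (by norm_num) Y

lemma Hm2_dot (μ τ : ℝ) (Y : Fin 55 → ℂ) (r : Fin 16) : HmB μ τ 2 r ⬝ᵥ Y =
    ![Y 23, Y 21, Y 31, Y 41, Y 18, Y 25, Y 0, Y 33, Y 28, Y 35, Y 4, Y 43,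
    Y 38, Y 45, Y 8, Y 13] r := by
  fin_cases r <;> exact e_dot _ (by norm_num) Y

lemma Hm3_dot (μ τ : ℝ) (Y : Fin 55 → ℂ) (r : Fin 16) : HmB μ τ 3 r ⬝ᵥ Y =
    ![Y 24, Y 22, Y 32, Y 42, Y 25, Y 19, Y 1, Y 34, Y 35, Y 29, Y 5, Y 44,
    Y 45, Y 39, Y 9, Y 14] r := by
  fin_cases r <;> exact e_dot _ (by norm_num) Y

/-- The nine free coordinates. -/
def wpart (Y : Fin 55 → ℂ) : Fin 9 → ℂ :=
  ![Y 46, Y 47, Y 48, Y 49, Y 50, Y 51, Y 52, Y 53, Y 54]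

/-- The reduced system of four scalar equations. -/
def Red (μ τ : ℝ) (ξ : Fin 4 → ℝ) (f : Fin 3 → ℂ) (y3 y7 y11 y16 : ℂ) (w : Fin 9 → ℂ) : Prop :=
  I * ξ 1 * y3 + I * ξ 2 * y7 + I * ξ 3 * y11 = 0 ∧
  τ * (I * ξ 1 * y16) - μ * ((I * ξ 1) ^ 2 * y3 + (I * ξ 2) ^ 2 * y3 + (I * ξ 3) ^ 2 * y3)
    + w 0 + w 1 + w 2 = f 0 - I * ξ 0 * y3 ∧
  τ * (I * ξ 2 * y16) - μ * ((I * ξ 1) ^ 2 * y7 + (I * ξ 2) ^ 2 * y7 + (I * ξ 3) ^ 2 * y7)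
    + w 3 + w 4 + w 5 = f 1 - I * ξ 0 * y7 ∧
  τ * (I * ξ 3 * y16) - μ * ((I * ξ 1) ^ 2 * y11 + (I * ξ 2) ^ 2 * y11 + (I * ξ 3) ^ 2 * y11)
    + w 6 + w 7 + w 8 = f 2 - I * ξ 0 * y11

lemma bwd (μ τ : ℝ) (ξ : Fin 4 → ℝ) (f : Fin 3 → ℂ) (y3 y7 y11 y16 : ℂ) (w : Fin 9 → ℂ)
    (h : Red μ τ ξ f y3 y7 y11 y16 w) :
    (B μ τ ξ).mulVec (Yv ξ y3 y7 y11 y16 w) = Gv ξ f := by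
  obtain ⟨h1, h2, h3, h4⟩ := h
  rw [B_iff]
  have d2 : α₂ μ τ ⬝ᵥ Yv ξ y3 y7 y11 y16 w = f 0 - I * ξ 0 * y3 := by
    rw [α₂_dot]; exact h2
  have d3 : α₃ μ τ ⬝ᵥ Yv ξ y3 y7 y11 y16 w = f 1 - I * ξ 0 * y7 := by
    rw [α₃_dot]; exact h3
  have d4 : α₄ μ τ ⬝ᵥ Yv ξ y3 y7 y11 y16 w = f 2 - I * ξ 0 * y11 := by
    rw [α₄_dot]; exact h4
  have d1 : Yv ξ y3 y7 y11 y16 w 4 + Yv ξ y3 y7 y11 y16 w 9 = - (I * ξ 1 * y3) := by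
    change I * ξ 2 * y7 + I * ξ 3 * y11 = _
    linear_combination h1
  intro k r
  rw [Hm_dot, d1, d2, d3, d4]
  revert r
  fin_cases k
  · change ∀ r, _ - HmB μ τ 0 r ⬝ᵥ _ = _
    simp only [Hm0_dot, d2, d3, d4]
    intro r
    fin_cases r <;> simp [Yv] <;> ring
  · change ∀ r, _ - HmB μ τ 1 r ⬝ᵥ _ = _
    simp only [Hm1_dot, d1]
    intro r
    fin_cases r <;> simp [Yv] <;> ring
  · change ∀ r, _ - HmB μ τ 2 r ⬝ᵥ _ = _
    simp only [Hm2_dot]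
    intro r
    fin_cases r <;> simp [Yv] <;> ring
  · change ∀ r, _ - HmB μ τ 3 r ⬝ᵥ _ = _
    simp only [Hm3_dot]
    intro r
    fin_cases r <;> simp [Yv] <;> ring

lemma fwd (μ τ : ℝ) (ξ : Fin 4 → ℝ) (f : Fin 3 → ℂ) (Y : Fin 55 → ℂ)
    (h : (B μ τ ξ).mulVec Y = Gv ξ f) :
    Y = Yv ξ (Y 2) (Y 6) (Y 10) (Y 15) (wpart Y) ∧
      Red μ τ ξ f (Y 2) (Y 6) (Y 10) (Y 15) (wpart Y) := by
  rw [B_iff] at h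
  have k0 := h 0
  have k1 := h 1
  have k2 := h 2
  have k3 := h 3
  clear h
  simp only [Hm_dot, Hm0_dot] at k0
  simp only [Hm_dot, Hm1_dot] at k1
  simp only [Hm_dot, Hm2_dot] at k2
  simp only [Hm_dot, Hm3_dot] at k3
  have A2 : α₂ μ τ ⬝ᵥ Y = f 0 - I * ξ 0 * Y 2 := by
    have := k0 6; simp at this; linear_combination this
  have A3 : α₃ μ τ ⬝ᵥ Y = f 1 - I * ξ 0 * Y 6 := by
    have := k0 10; simp at this; linear_combination this
  have A4 : α₄ μ τ ⬝ᵥ Y = f 2 - I * ξ 0 * Y 10 := by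
    have := k0 14; simp at this; linear_combination this
  have A1 : Y 4 + Y 9 = - (I * ξ 1 * Y 2) := by
    have := k1 6; simp at this; linear_combination this
  have y0 : Y 0 = I * ξ 2 * Y 2 := by
    have := k2 6; simp at this; linear_combination -this
  have y1 : Y 1 = I * ξ 3 * Y 2 := by
    have := k3 6; simp at this; linear_combination -this
  have y3 : Y 3 = I * ξ 1 * Y 6 := by
    have := k1 10; simp at this; linear_combination -this
  have y4 : Y 4 = I * ξ 2 * Y 6 := by
    have := k2 10; simp at this; linear_combination -this
  have y5 : Y 5 = I * ξ 3 * Y 6 := by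
    have := k3 10; simp at this; linear_combination -this
  have y7 : Y 7 = I * ξ 1 * Y 10 := by
    have := k1 14; simp at this; linear_combination -this
  have y8 : Y 8 = I * ξ 2 * Y 10 := by
    have := k2 14; simp at this; linear_combination -this
  have y9 : Y 9 = I * ξ 3 * Y 10 := by
    have := k3 14; simp at this; linear_combination -this
  have y11 : Y 11 = I * ξ 0 * Y 15 := by
    have := k0 15; simp at this; linear_combination -this
  have y12 : Y 12 = I * ξ 1 * Y 15 := by
    have := k1 15; simp at this; linear_combination -this
  have y13 : Y 13 = I * ξ 2 * Y 15 := by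
    have := k2 15; simp at this; linear_combination -this
  have y14 : Y 14 = I * ξ 3 * Y 15 := by
    have := k3 15; simp at this; linear_combination -this
  have y16 : Y 16 = (I * ξ 0) ^ 2 * Y 2 := by
    have := k0 1; simp at this; linear_combination -this - I * ξ 0 * A2
  have y17 : Y 17 = (I * ξ 1) ^ 2 * Y 2 := by
    have := k1 0; simp at this; linear_combination -this - I * ξ 1 * A1
  have y18 : Y 18 = (I * ξ 2) ^ 2 * Y 2 := by
    have := k2 4; simp at this; linear_combination -this + I * ξ 2 * y0
  have y19 : Y 19 = (I * ξ 3) ^ 2 * Y 2 := by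
    have := k3 5; simp at this; linear_combination -this + I * ξ 3 * y1
  have y20 : Y 20 = I * ξ 0 * (I * ξ 1) * Y 2 := by
    have := k0 0; simp at this; linear_combination -this - I * ξ 0 * A1
  have y21 : Y 21 = I * ξ 0 * (I * ξ 2) * Y 2 := by
    have := k0 4; simp at this; linear_combination -this + I * ξ 0 * y0
  have y22 : Y 22 = I * ξ 0 * (I * ξ 3) * Y 2 := by
    have := k0 5; simp at this; linear_combination -this + I * ξ 0 * y1
  have y23 : Y 23 = I * ξ 1 * (I * ξ 2) * Y 2 := by
    have := k1 4; simp at this; linear_combination -this + I * ξ 1 * y0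
  have y24 : Y 24 = I * ξ 1 * (I * ξ 3) * Y 2 := by
    have := k1 5; simp at this; linear_combination -this + I * ξ 1 * y1
  have y25 : Y 25 = I * ξ 2 * (I * ξ 3) * Y 2 := by
    have := k2 5; simp at this; linear_combination -this + I * ξ 2 * y1
  have y26 : Y 26 = (I * ξ 0) ^ 2 * Y 6 := by
    have := k0 2; simp at this; linear_combination -this - I * ξ 0 * A3
  have y27 : Y 27 = (I * ξ 1) ^ 2 * Y 6 := by
    have := k1 7; simp at this; linear_combination -this + I * ξ 1 * y3
  have y28 : Y 28 = (I * ξ 2) ^ 2 * Y 6 := by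
    have := k2 8; simp at this; linear_combination -this + I * ξ 2 * y4
  have y29 : Y 29 = (I * ξ 3) ^ 2 * Y 6 := by
    have := k3 9; simp at this; linear_combination -this + I * ξ 3 * y5
  have y30 : Y 30 = I * ξ 0 * (I * ξ 1) * Y 6 := by
    have := k0 7; simp at this; linear_combination -this + I * ξ 0 * y3
  have y31 : Y 31 = I * ξ 0 * (I * ξ 2) * Y 6 := by
    have := k0 8; simp at this; linear_combination -this + I * ξ 0 * y4
  have y32 : Y 32 = I * ξ 0 * (I * ξ 3) * Y 6 := by
    have := k0 9; simp at this; linear_combination -this + I * ξ 0 * y5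
  have y33 : Y 33 = I * ξ 1 * (I * ξ 2) * Y 6 := by
    have := k1 8; simp at this; linear_combination -this + I * ξ 1 * y4
  have y34 : Y 34 = I * ξ 1 * (I * ξ 3) * Y 6 := by
    have := k1 9; simp at this; linear_combination -this + I * ξ 1 * y5
  have y35 : Y 35 = I * ξ 2 * (I * ξ 3) * Y 6 := by
    have := k2 9; simp at this; linear_combination -this + I * ξ 2 * y5
  have y36 : Y 36 = (I * ξ 0) ^ 2 * Y 10 := by
    have := k0 3; simp at this; linear_combination -this - I * ξ 0 * A4
  have y37 : Y 37 = (I * ξ 1) ^ 2 * Y 10 := by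
    have := k1 11; simp at this; linear_combination -this + I * ξ 1 * y7
  have y38 : Y 38 = (I * ξ 2) ^ 2 * Y 10 := by
    have := k2 12; simp at this; linear_combination -this + I * ξ 2 * y8
  have y39 : Y 39 = (I * ξ 3) ^ 2 * Y 10 := by
    have := k3 13; simp at this; linear_combination -this + I * ξ 3 * y9
  have y40 : Y 40 = I * ξ 0 * (I * ξ 1) * Y 10 := by
    have := k0 11; simp at this; linear_combination -this + I * ξ 0 * y7
  have y41 : Y 41 = I * ξ 0 * (I * ξ 2) * Y 10 := by
    have := k0 12; simp at this; linear_combination -this + I * ξ 0 * y8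
  have y42 : Y 42 = I * ξ 0 * (I * ξ 3) * Y 10 := by
    have := k0 13; simp at this; linear_combination -this + I * ξ 0 * y9
  have y43 : Y 43 = I * ξ 1 * (I * ξ 2) * Y 10 := by
    have := k1 12; simp at this; linear_combination -this + I * ξ 1 * y8
  have y44 : Y 44 = I * ξ 1 * (I * ξ 3) * Y 10 := by
    have := k1 13; simp at this; linear_combination -this + I * ξ 1 * y9
  have y45 : Y 45 = I * ξ 2 * (I * ξ 3) * Y 10 := by
    have := k2 13; simp at this; linear_combination -this + I * ξ 2 * y9
  refine ⟨?_, ?_, ?_, ?_, ?_⟩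
  · funext i
    fin_cases i
    exacts [y0, y1, rfl, y3, y4, y5, rfl, y7, y8, y9, rfl, y11, y12, y13, y14, rfl,
      y16, y17, y18, y19, y20, y21, y22, y23, y24, y25, y26, y27, y28, y29, y30, y31,
      y32, y33, y34, y35, y36, y37, y38, y39, y40, y41, y42, y43, y44, y45, rfl, rfl,
      rfl, rfl, rfl, rfl, rfl, rfl, rfl]
  · linear_combination A1 - y4 - y9
  · rw [α₂_dot, y12, y17, y18, y19] at A2
    exact A2
  · rw [α₃_dot, y13, y27, y28, y29] at A3
    exact A3
  · rw [α₄_dot, y14, y37, y38, y39] at A4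
    exact A4

lemma Yv_add (ξ : Fin 4 → ℝ) (a b c d a2 b2 c2 d2 : ℂ) (w w2 : Fin 9 → ℂ) :
    Yv ξ a b c d w + Yv ξ a2 b2 c2 d2 w2 = Yv ξ (a + a2) (b + b2) (c + c2) (d + d2) (w + w2) := by
  simp only [Yv, Matrix.cons_add_cons, mul_add, Pi.add_apply, Matrix.empty_add_empty]

lemma Yv_smul (ξ : Fin 4 → ℝ) (t a b c d : ℂ) (w : Fin 9 → ℂ) :
    t • Yv ξ a b c d w = Yv ξ (t * a) (t * b) (t * c) (t * d) (t • w) := by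
  simp only [Yv, Matrix.smul_cons, smul_eq_mul, Pi.smul_apply, Matrix.smul_empty, mul_left_comm t]

lemma Yv_w (ξ : Fin 4 → ℝ) (a b c d : ℂ) (w : Fin 9 → ℂ) : wpart (Yv ξ a b c d w) = w := by
  funext i
  fin_cases i <;> rfl

lemma η_lo (μ τ : ℝ) (ξ : Fin 4 → ℝ) (j : Fin 9) (h : (j : ℕ) < 3) :
    ηv μ τ ξ j = Yv ξ ((ξ 1 : ℂ) ^ 2 / (aC μ τ ξ ^ 2 * bC μ τ ξ * (τ : ℂ)) + 1 / (aC μ τ ξ * τ))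
      ((ξ 1 : ℂ) * (ξ 2 : ℂ) / (aC μ τ ξ ^ 2 * bC μ τ ξ * (τ : ℂ)))
      ((ξ 1 : ℂ) * (ξ 3 : ℂ) / (aC μ τ ξ ^ 2 * bC μ τ ξ * (τ : ℂ)))
      (-(I * ξ 1) / (aC μ τ ξ * bC μ τ ξ * τ)) (eh j) :=
  if_pos h

lemma η_mid (μ τ : ℝ) (ξ : Fin 4 → ℝ) (j : Fin 9) (h : ¬ (j : ℕ) < 3) (h2 : (j : ℕ) < 6) :
    ηv μ τ ξ j = Yv ξ ((ξ 1 : ℂ) * (ξ 2 : ℂ) / (aC μ τ ξ ^ 2 * bC μ τ ξ * (τ : ℂ)))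
      ((ξ 2 : ℂ) ^ 2 / (aC μ τ ξ ^ 2 * bC μ τ ξ * (τ : ℂ)) + 1 / (aC μ τ ξ * τ))
      ((ξ 2 : ℂ) * (ξ 3 : ℂ) / (aC μ τ ξ ^ 2 * bC μ τ ξ * (τ : ℂ)))
      (-(I * ξ 2) / (aC μ τ ξ * bC μ τ ξ * τ)) (eh j) :=
  (if_neg h).trans (if_pos h2)

lemma η_hi (μ τ : ℝ) (ξ : Fin 4 → ℝ) (j : Fin 9) (h : ¬ (j : ℕ) < 3) (h2 : ¬ (j : ℕ) < 6) :
    ηv μ τ ξ j = Yv ξ ((ξ 1 : ℂ) * (ξ 3 : ℂ) / (aC μ τ ξ ^ 2 * bC μ τ ξ * (τ : ℂ)))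
      ((ξ 2 : ℂ) * (ξ 3 : ℂ) / (aC μ τ ξ ^ 2 * bC μ τ ξ * (τ : ℂ)))
      ((ξ 3 : ℂ) ^ 2 / (aC μ τ ξ ^ 2 * bC μ τ ξ * (τ : ℂ)) + 1 / (aC μ τ ξ * τ))
      (-(I * ξ 3) / (aC μ τ ξ * bC μ τ ξ * τ)) (eh j) :=
  (if_neg h).trans (if_neg h2)

lemma rhs_eq (μ τ : ℝ) (ξ : Fin 4 → ℝ) (f : Fin 3 → ℂ) (c : Fin 9 → ℂ)
    (W1 W2 W3 T a b D : ℂ) (ha : a = aC μ τ ξ) (hb : b = bC μ τ ξ) (hD : D = a ^ 2 * b * τ)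
    (h1 : W1 = f 0 - (c 0 + c 1 + c 2)) (h2 : W2 = f 1 - (c 3 + c 4 + c 5))
    (h3 : W3 = f 2 - (c 6 + c 7 + c 8))
    (hT : T = I * ξ 1 * W1 + I * ξ 2 * W2 + I * ξ 3 * W3) :
    Y1 μ τ ξ f + ∑ j, c j • ηv μ τ ξ j =
      Yv ξ (I * ξ 1 * T / D - W1 / (a * τ)) (I * ξ 2 * T / D - W2 / (a * τ))
        (I * ξ 3 * T / D - W3 / (a * τ)) (T / (a * b * τ)) c := by
  simp only [Fin.sum_univ_succ, Fin.sum_univ_zero, add_zero]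
  change _ + (c 0 • ηv μ τ ξ 0 + (c 1 • ηv μ τ ξ 1 + (c 2 • ηv μ τ ξ 2 + (c 3 • ηv μ τ ξ 3 +
    (c 4 • ηv μ τ ξ 4 + (c 5 • ηv μ τ ξ 5 + (c 6 • ηv μ τ ξ 6 + (c 7 • ηv μ τ ξ 7 +
    c 8 • ηv μ τ ξ 8)))))))) = _
  rw [η_lo μ τ ξ 0 (by decide), η_lo μ τ ξ 1 (by decide), η_lo μ τ ξ 2 (by decide),
    η_mid μ τ ξ 3 (by decide) (by decide), η_mid μ τ ξ 4 (by decide) (by decide),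
    η_mid μ τ ξ 5 (by decide) (by decide), η_hi μ τ ξ 6 (by decide) (by decide),
    η_hi μ τ ξ 7 (by decide) (by decide), η_hi μ τ ξ 8 (by decide) (by decide)]
  simp only [Y1, Yv_smul, Yv_add]
  simp only [← ha, ← hb, ← hD]
  have hI : I ^ 2 = -1 := I_sq
  congr 1
  · rw [hT, h1, h2, h3]; ring_nf; rw [hI]; ring
  · rw [hT, h1, h2, h3]; ring_nf; rw [hI]; ring
  · rw [hT, h1, h2, h3]; ring_nf; rw [hI]; ring
  · rw [hT, h1, h2, h3]; ring
  · funext i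
    fin_cases i <;> simp [eh]

lemma spatial_ne (ξ : Fin 4 → ℝ) (hξ : ¬(ξ 1 = 0 ∧ ξ 2 = 0 ∧ ξ 3 = 0)) :
    ξ 1 ^ 2 + ξ 2 ^ 2 + ξ 3 ^ 2 ≠ 0 := by
  intro h
  apply hξ
  refine ⟨?_, ?_, ?_⟩ <;> nlinarith [sq_nonneg (ξ 1), sq_nonneg (ξ 2), sq_nonneg (ξ 3)]

lemma aC_ne (μ τ : ℝ) (hμ : 0 < μ) (hτ : 0 < τ) (ξ : Fin 4 → ℝ)
    (hξ : ¬(ξ 1 = 0 ∧ ξ 2 = 0 ∧ ξ 3 = 0)) : aC μ τ ξ ≠ 0 := by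
  have hs := spatial_ne ξ hξ
  unfold aC
  refine div_ne_zero ?_ (by exact_mod_cast hτ.ne')
  intro h
  have h2 := congrArg Complex.re h
  simp [mul_pow, ← Complex.ofReal_pow] at h2
  rcases h2 with h2 | h2
  · exact hμ.ne' h2
  · exact hs (by linarith)

lemma z_ne (ξ : Fin 4 → ℝ) (hξ : ¬(ξ 1 = 0 ∧ ξ 2 = 0 ∧ ξ 3 = 0)) :
    (I * ξ 1) ^ 2 + (I * ξ 2) ^ 2 + (I * ξ 3) ^ 2 ≠ 0 := by
  have hs := spatial_ne ξ hξ
  intro h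
  simp only [mul_pow, I_sq] at h
  apply hs
  have : ((ξ 1 ^ 2 + ξ 2 ^ 2 + ξ 3 ^ 2 : ℝ) : ℂ) = 0 := by
    push_cast
    linear_combination -h
  exact_mod_cast this

lemma solve (μ τ : ℝ) (hμ : 0 < μ) (hτ : 0 < τ) (ξ : Fin 4 → ℝ)
    (hξ : ¬(ξ 1 = 0 ∧ ξ 2 = 0 ∧ ξ 3 = 0)) (f : Fin 3 → ℂ) (c : Fin 9 → ℂ)
    (W1 W2 W3 T a b D : ℂ) (ha : a = aC μ τ ξ) (hb : b = bC μ τ ξ) (hD : D = a ^ 2 * b * τ)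
    (h1 : W1 = f 0 - (c 0 + c 1 + c 2)) (h2 : W2 = f 1 - (c 3 + c 4 + c 5))
    (h3 : W3 = f 2 - (c 6 + c 7 + c 8))
    (hT : T = I * ξ 1 * W1 + I * ξ 2 * W2 + I * ξ 3 * W3) (y3 y7 y11 y16 : ℂ) :
    Red μ τ ξ f y3 y7 y11 y16 c ↔
      (y3 = I * ξ 1 * T / D - W1 / (a * τ) ∧ y7 = I * ξ 2 * T / D - W2 / (a * τ) ∧
        y11 = I * ξ 3 * T / D - W3 / (a * τ) ∧ y16 = T / (a * b * τ)) := by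
  have hz := z_ne ξ hξ
  have ha0 := aC_ne μ τ hμ hτ ξ hξ
  have hτ0 : (τ : ℂ) ≠ 0 := by exact_mod_cast hτ.ne'
  have hab : a * b = (I * ξ 1) ^ 2 + (I * ξ 2) ^ 2 + (I * ξ 3) ^ 2 := by
    rw [ha, hb, bC]; field_simp
  have haτ : a * τ = μ * ((I * ξ 1) ^ 2 + (I * ξ 2) ^ 2 + (I * ξ 3) ^ 2) - I * ξ 0 := by
    rw [ha, aC]; field_simp
  rw [← ha] at ha0
  have hb0 : b ≠ 0 := by
    rintro rfl
    apply hz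
    rw [← hab, mul_zero]
  clear ha hb
  unfold Red
  generalize I * (ξ 0 : ℂ) = z0 at *
  generalize I * (ξ 1 : ℂ) = z1 at *
  generalize I * (ξ 2 : ℂ) = z2 at *
  generalize I * (ξ 3 : ℂ) = z3 at *
  subst hD
  constructor
  · rintro ⟨r1, r2, r3, r4⟩
    have q0 : y16 * (a * b * τ) = T := by
      rw [hT, h1, h2, h3]
      linear_combination y16 * τ * hab + z1 * r2 + z2 * r3 + z3 * r4 + a * τ * r1 +
        (-z1 * y3 - z2 * y7 - z3 * y11) * haτ
    have q : y16 = T / (a * b * τ) := by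
      rw [eq_div_iff (by simp [ha0, hb0, hτ0]), q0]
    have e (z y W : ℂ) (hy : τ * (z * y16) - a * τ * y = W) :
        y = z * T / (a ^ 2 * b * τ) - W / (a * τ) := by
      rw [← hy, ← q0]
      field_simp
      ring
    refine ⟨e _ _ _ ?_, e _ _ _ ?_, e _ _ _ ?_, q⟩
    · rw [h1]; linear_combination r2 - y3 * haτ
    · rw [h2]; linear_combination r3 - y7 * haτ
    · rw [h3]; linear_combination r4 - y11 * haτ
  · rintro ⟨r1, r2, r3, r4⟩
    have e (z y W : ℂ) (hy : y = z * T / (a ^ 2 * b * τ) - W / (a * τ)) :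
        τ * (z * y16) - a * τ * y = W := by
      rw [hy, r4]
      field_simp
      ring
    have q0 : y16 * (a * b * τ) = T := by
      rw [r4]
      field_simp
    have s1 := e _ _ _ r1
    have s2 := e _ _ _ r2
    have s3 := e _ _ _ r3
    refine ⟨?_, ?_, ?_, ?_⟩
    · have : a * τ * (z1 * y3 + z2 * y7 + z3 * y11) = 0 := by
        linear_combination -z1 * s1 - z2 * s2 - z3 * s3 + q0 + hT - y16 * τ * hab
      simpa [ha0, hτ0] using this
    · linear_combination s1 + h1 + y3 * haτ
    · linear_combination s2 + h2 + y7 * haτ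
    · linear_combination s3 + h3 + y11 * haτ

theorem stmt7 (μ τ : ℝ) (hμ : 0 < μ) (hτ : 0 < τ)
    (ξ : Fin 4 → ℝ) (hξ : ¬(ξ 1 = 0 ∧ ξ 2 = 0 ∧ ξ 3 = 0)) (f : Fin 3 → ℂ)
    (Y : Fin 55 → ℂ) :
    (B μ τ ξ).mulVec Y = Gv ξ f ↔
      (∃! c : Fin 9 → ℂ, Y = Y1 μ τ ξ f + ∑ j, c j • ηv μ τ ξ j) := by
  constructor
  · intro h
    obtain ⟨hY, hR⟩ := fwd μ τ ξ f Y h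
    refine ⟨wpart Y, ?_, ?_⟩
    · change Y = _
      rw [solve μ τ hμ hτ ξ hξ f _ _ _ _ _ _ _ _ rfl rfl rfl rfl rfl rfl rfl] at hR
      obtain ⟨r1, r2, r3, r4⟩ := hR
      rw [rhs_eq μ τ ξ f _ _ _ _ _ _ _ _ rfl rfl rfl rfl rfl rfl rfl, ← r1, ← r2, ← r3, ← r4]
      exact hY
    · intro c hc
      change Y = _ at hc
      rw [hc, rhs_eq μ τ ξ f _ _ _ _ _ _ _ _ rfl rfl rfl rfl rfl rfl rfl, Yv_w]
  · rintro ⟨c, hc, -⟩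
    change Y = _ at hc
    rw [hc, rhs_eq μ τ ξ f _ _ _ _ _ _ _ _ rfl rfl rfl rfl rfl rfl rfl]
    apply bwd
    rw [solve μ τ hμ hτ ξ hξ f _ _ _ _ _ _ _ _ rfl rfl rfl rfl rfl rfl rfl]
    exact ⟨rfl, rfl, rfl, rfl⟩
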